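/- arXiv:1111.6549 — 3 statements merged into one kernel-verified Lean document; each statement's English description precedes it below -/
import Mathlib

section
/- Let A = P · L · E be a PLE decomposition of an m × n matrix A over 𝔽₂, where P is an m × m permutation matrix, L is an m × m unit lower triangular matrix, and E is an m × n matrix in row echelon form. Then the sequence of column indices of the leading entries of the non-zero rows of E equals the column rank profile of A. -/
/-- Row echelon form over `𝔽₂`. -/
def IsRowEchelon {m n : ℕ} (A : Matrix (Fin m) (Fin n) (ZMod 2)) : Prop :=
  (∀ i i' : Fin m, i ≤ i' → A i = 0 → A i' = 0) ∧
  (∀ i i' : Fin m, i < i' → ∀ j j' : Fin n,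
    (A i j ≠ 0 ∧ ∀ l, l < j → A i l = 0) →
    (A i' j' ≠ 0 ∧ ∀ l, l < j' → A i' l = 0) → j < j')

/-- `c` is the column rank profile of `A`: the lexicographically smallest strictly
increasing sequence of `r` column indices whose corresponding columns are linearly
independent. -/
def IsColRankProfile {m n r : ℕ} (A : Matrix (Fin m) (Fin n) (ZMod 2))
    (c : Fin r → Fin n) : Prop :=
  StrictMono c ∧
  LinearIndependent (ZMod 2) (fun s : Fin r => fun i : Fin m => A i (c s)) ∧
  ∀ d : Fin r → Fin n, StrictMono d →
    LinearIndependent (ZMod 2) (fun s : Fin r => fun i : Fin m => A i (d s)) →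
    c = d ∨ ∃ s : Fin r, c s < d s ∧ ∀ t : Fin r, t < s → c t = d t

namespace IsRowEchelon

variable {m n : ℕ} {E : Matrix (Fin m) (Fin n) (ZMod 2)}

/-- To the left of the leading entry of a row, all lower rows of an echelon form vanish. -/
theorem apply_eq_zero (hE : IsRowEchelon E) {i i' : Fin m} {k j : Fin n} (hii' : i ≤ i')
    (hk : E i k ≠ 0 ∧ ∀ l, l < k → E i l = 0) (hj : j < k) : E i' j = 0 := by
  rcases hii'.eq_or_lt with rfl | hlt
  · exact hk.2 j hj
  induction j using WellFoundedLT.induction with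
  | _ j ih =>
    by_contra h
    exact (hE.2 i i' hlt k j hk ⟨h, fun l hl => ih l hl (hl.trans hj)⟩).not_gt hj

end IsRowEchelon

/-- Multiplying on the left by an invertible matrix preserves linear independence of columns. -/
theorem Matrix.linearIndependent_col_mul_iff {ι m n K : Type*} [Fintype m] [DecidableEq m]
    [Field K] {M : Matrix m m K} (hM : IsUnit M) (E : Matrix m n K) (d : ι → n) :
    LinearIndependent K (fun s i => (M * E) i (d s)) ↔
      LinearIndependent K (fun s i => E i (d s)) := by
  have hker : LinearMap.ker M.mulVecLin = ⊥ :=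
    LinearMap.ker_eq_bot.2 (Matrix.mulVec_injective_of_isUnit hM)
  exact M.mulVecLin.linearIndependent_iff (v := fun s i => E i (d s)) hker

/-- Linearly independent vectors supported on a set of coordinates are at most as many as
these coordinates. -/
theorem LinearIndependent.card_le_of_support {ι κ η K : Type*} [Fintype ι] [Fintype κ] [Field K]
    {v : ι → η → K} (hv : LinearIndependent K v) (f : κ → η)
    (hf : ∀ t i, i ∉ Set.range f → v t i = 0) : Fintype.card ι ≤ Fintype.card κ := by
  have h : LinearIndependent K (fun t k => v t (f k)) := by
    rw [Fintype.linearIndependent_iff] at hv ⊢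
    intro g hg
    refine hv g (funext fun i => ?_)
    by_cases hi : i ∈ Set.range f
    · obtain ⟨k, rfl⟩ := hi
      simpa using congrFun hg k
    · simp [hf _ i hi]
  simpa using h.fintype_card_le_finrank

/-- The sequence of leading columns of the first `r` rows of an echelon form is its column rank
profile, as soon as these rows are non-zero. -/
theorem IsRowEchelon.isColRankProfile {m n r : ℕ} {E : Matrix (Fin m) (Fin n) (ZMod 2)}
    (hE : IsRowEchelon E) {c : Fin r → Fin n}
    (hc : ∀ s : Fin r, ∃ hs : (s : ℕ) < m,
      E ⟨(s : ℕ), hs⟩ (c s) ≠ 0 ∧ ∀ l : Fin n, l < c s → E ⟨(s : ℕ), hs⟩ l = 0) :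
    IsColRankProfile E c := by
  choose hm hc using hc
  have hmono : StrictMono c := fun s t hst =>
    hE.2 ⟨s, hm s⟩ ⟨t, hm t⟩ hst _ _ (hc s) (hc t)
  refine ⟨hmono, ?_, fun d hd hind => ?_⟩
  · let B : Matrix (Fin r) (Fin r) (ZMod 2) := Matrix.of fun i s => E ⟨i, hm i⟩ (c s)
    have hB : B.det ≠ 0 := by
      have htri : B.IsUpperTriangular := fun i s his => (hc i).2 _ (hmono his)
      rw [Matrix.det_of_isUpperTriangular htri]
      exact Finset.prod_ne_zero_iff.2 fun i _ => (hc i).1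
    exact (Matrix.linearIndependent_cols_of_det_ne_zero hB).of_comp
      (LinearMap.funLeft (ZMod 2) (ZMod 2) fun i : Fin r => (⟨i, hm i⟩ : Fin m))
  · by_contra! h
    obtain ⟨hne, h⟩ := h
    obtain ⟨s, hs, hmin⟩ : ∃ s, c s ≠ d s ∧ ∀ t < s, c t = d t := by
      obtain ⟨s, hs, hmin⟩ := WellFounded.has_min (wellFounded_lt (α := Fin r))
        {s | c s ≠ d s} (Function.ne_iff.1 hne)
      exact ⟨s, hs, fun t ht => not_not.1 fun h => hmin t h ht⟩
    have hlt : d s < c s := by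
      by_contra! hle
      obtain ⟨t, ht, hne⟩ := h s (hle.lt_of_ne hs)
      exact hne (hmin t ht)
    have hcard := (hind.comp (Subtype.val : Set.Iic s → Fin r)
      Subtype.val_injective).card_le_of_support
      (fun k : Set.Iio s => (⟨k.1, hm k.1⟩ : Fin m)) fun t i hi => by
        refine hE.apply_eq_zero (i := ⟨s, hm s⟩) ?_ (hc s) ((hd.monotone t.2).trans_lt hlt)
        by_contra! hlt
        exact hi ⟨⟨⟨i, (Fin.lt_def.1 hlt).trans s.2⟩, hlt⟩, rfl⟩
    rw [← Set.toFinset_card, ← Set.toFinset_card, Set.toFinset_Iic, Set.toFinset_Iio,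
      Fin.card_Iic, Fin.card_Iio] at hcard
    lia

/-- If `A = P * L * E` is a PLE decomposition of `A` over `𝔽₂` (`P` a permutation
matrix, `L` unit lower triangular, `E` in row echelon form), then the sequence of
column indices of the leading entries of the non-zero rows of `E` is the column
rank profile of `A`. -/
theorem ple_leading_entries_eq_colRankProfile {m n : ℕ}
    (A : Matrix (Fin m) (Fin n) (ZMod 2)) (P L : Matrix (Fin m) (Fin m) (ZMod 2))
    (E : Matrix (Fin m) (Fin n) (ZMod 2)) (σ : Equiv.Perm (Fin m))
    (hP : P = σ.permMatrix (ZMod 2))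
    (hLlow : ∀ i j : Fin m, i < j → L i j = 0) (hLdiag : ∀ i : Fin m, L i i = 1)
    (hE : IsRowEchelon E) (hA : A = P * L * E)
    (c : Fin A.rank → Fin n)
    (hc : ∀ s : Fin A.rank, ∃ hs : (s : ℕ) < m,
        E ⟨(s : ℕ), hs⟩ (c s) ≠ 0 ∧ ∀ l : Fin n, l < c s → E ⟨(s : ℕ), hs⟩ l = 0) :
    IsColRankProfile A c := by
  have hL : IsUnit L := by
    rw [Matrix.isUnit_iff_isUnit_det, Matrix.det_of_isLowerTriangular L hLlow]
    simp [hLdiag]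
  have hM : IsUnit (P * L) := by
    refine IsUnit.mul ?_ hL
    rw [hP, Matrix.isUnit_iff_isUnit_det, Matrix.det_permutation]
    exact (Units.map (Int.castRingHom (ZMod 2)).toMonoidHom (Equiv.Perm.sign σ)).isUnit
  obtain ⟨hmono, hind, hmin⟩ := hE.isColRankProfile hc
  have hiff {r : ℕ} (d : Fin r → Fin n) :
      LinearIndependent (ZMod 2) (fun s i => A i (d s)) ↔
        LinearIndependent (ZMod 2) (fun s i => E i (d s)) :=
    hA ▸ Matrix.linearIndependent_col_mul_iff hM E d
  exact ⟨hmono, (hiff c).2 hind, fun d hd h => hmin d hd ((hiff d).1 h)⟩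
end

section
/- The LAPACK-style representation of a permutation is unique: if P = (P₀, …, P_{m−1}) and P' = (P'₀, …, P'_{m−1}) both satisfy i ≤ P_i < m and i ≤ P'_i < m for all i, and the composition swap(m−1, P_{m−1}) ∘ … ∘ swap(0, P₀) equals the composition swap(m−1, P'_{m−1}) ∘ … ∘ swap(0, P'₀) as permutations of {0, …, m−1}, then P_i = P'_i for all i. -/
/-- A product of transpositions moving only elements above `a` fixes `a`. -/
theorem prod_reverse_map_swap_apply_of_lt {α : Type*} [LinearOrder α] {P : α → α}
    (hP : ∀ i, i ≤ P i) {a : α} {l : List α} (hl : ∀ i ∈ l, a < i) :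
    (l.reverse.map (fun i => Equiv.swap i (P i))).prod a = a := by
  induction l with
  | nil => simp
  | cons b l ih =>
    have hb : a < b := hl b (by simp)
    simp only [List.reverse_cons, List.map_append, List.map_cons, List.map_nil, List.prod_append,
      List.prod_singleton, Equiv.Perm.mul_apply]
    rw [Equiv.swap_apply_of_ne_of_ne hb.ne (hb.trans_le (hP b)).ne]
    exact ih fun i hi => hl i (by simp [hi])

/-- Along a strictly increasing list, the product of the transpositions `swap i (P i)` with
`i ≤ P i`, smallest `i` applied first, determines `P` on the list. -/
theorem eq_of_prod_reverse_map_swap_eq {α : Type*} [LinearOrder α] {P P' : α → α}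
    (hP : ∀ i, i ≤ P i) (hP' : ∀ i, i ≤ P' i) {l : List α} (hl : l.Pairwise (· < ·))
    (h : (l.reverse.map (fun i => Equiv.swap i (P i))).prod
        = (l.reverse.map (fun i => Equiv.swap i (P' i))).prod) :
    ∀ i ∈ l, P i = P' i := by
  induction l with
  | nil => simp
  | cons a l ih =>
    obtain ⟨ha, hl⟩ := List.pairwise_cons.mp hl
    simp only [List.reverse_cons, List.map_append, List.map_cons, List.map_nil, List.prod_append,
      List.prod_singleton] at h
    have hPa : P a = P' a := by
      apply (Equiv.injective _ : Function.Injective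
        ((l.reverse.map (fun i => Equiv.swap i (P i))).prod * Equiv.swap a (P a)))
      conv_rhs => rw [h]
      simp only [Equiv.Perm.mul_apply, Equiv.swap_apply_right]
      rw [prod_reverse_map_swap_apply_of_lt hP ha, prod_reverse_map_swap_apply_of_lt hP' ha]
    rw [hPa] at h
    exact List.forall_mem_cons.mpr ⟨hPa, ih hl (mul_right_cancel h)⟩

/-- The LAPACK-style representation of a permutation of `{0, …, m−1}` is unique:
if `P` and `P'` both satisfy `i ≤ P i < m` and `i ≤ P' i < m` for all `i`, and
`swap(m−1, P (m−1)) ∘ … ∘ swap(0, P 0) = swap(m−1, P' (m−1)) ∘ … ∘ swap(0, P' 0)`,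
then `P = P'`. -/
theorem lapack_perm_representation_unique (m : ℕ) (P P' : Fin m → Fin m)
    (hP : ∀ i : Fin m, i ≤ P i) (hP' : ∀ i : Fin m, i ≤ P' i)
    (h : (((List.finRange m).reverse).map (fun i => Equiv.swap i (P i))).prod
        = (((List.finRange m).reverse).map (fun i => Equiv.swap i (P' i))).prod) :
    ∀ i : Fin m, P i = P' i := by
  exact fun i => eq_of_prod_reverse_map_swap_eq hP hP' (List.pairwise_lt_finRange m) h i (List.mem_finRange i)
end

section
/- Let x and y be 64-bit words (bitvectors of length 64), let 0 ≤ b_b ≤ a_b < 64, let Δ = a_b − b_b, let a_m be the word whose only set bit is in position a_b and b_m the word whose only set bit is in position b_b. Define x₁ = x XOR ((y AND b_m) <<< Δ), y₁ = y XOR ((x₁ AND a_m) >>> Δ), x₂ = x₁ XOR ((y₁ AND b_m) <<< Δ). Then bit a_b of x₂ equals bit b_b of y, bit b_b of y₁ equals bit a_b of x, every bit of x₂ other than bit a_b equals the corresponding bit of x, and every bit of y₁ other than bit b_b equals the corresponding bit of y. -/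
theorem BitVec.getLsbD_one_shiftLeft {w b : ℕ} (hb : b < w) (i : ℕ) :
    (1#w <<< b).getLsbD i = decide (i = b) := by
  rw [Bool.eq_iff_iff]
  simp [BitVec.getLsbD_shiftLeft, BitVec.getLsbD_one]
  omega

theorem BitVec.getLsbD_and_one_shiftLeft_shiftLeft {w a b : ℕ} (hba : b ≤ a) (ha : a < w)
    (y : BitVec w) (i : ℕ) :
    ((y &&& 1#w <<< b) <<< (a - b)).getLsbD i = (decide (i = a) && y.getLsbD b) := by
  rw [BitVec.getLsbD_shiftLeft, BitVec.getLsbD_and, BitVec.getLsbD_one_shiftLeft (by omega)]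
  by_cases hi : i = a
  · subst hi
    simp [ha, Nat.sub_sub_self hba]
  · have : i < a - b ∨ i - (a - b) ≠ b := by omega
    rcases this with h | h <;> simp [hi, h]

theorem BitVec.getLsbD_and_one_shiftLeft_ushiftRight {w a b : ℕ} (hba : b ≤ a) (ha : a < w)
    (x : BitVec w) (i : ℕ) :
    ((x &&& 1#w <<< a) >>> (a - b)).getLsbD i = (decide (i = b) && x.getLsbD a) := by
  rw [BitVec.getLsbD_ushiftRight, BitVec.getLsbD_and, BitVec.getLsbD_one_shiftLeft ha]
  by_cases hi : i = b
  · subst hi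
    simp [Nat.sub_add_cancel hba]
  · have h : a - b + i ≠ a := by omega
    simp [hi, h]


/-- Correctness of the branch-free column-swap inner loop: given 64-bit words `x`, `y`,
bit positions `b_b ≤ a_b < 64`, `Δ = a_b − b_b`, and masks `a_m`, `b_m` whose only set
bits are at positions `a_b` and `b_b` respectively, the three masked XOR-shift steps
`x₁ = x XOR ((y AND b_m) <<< Δ)`, `y₁ = y XOR ((x₁ AND a_m) >>> Δ)`,
`x₂ = x₁ XOR ((y₁ AND b_m) <<< Δ)` exchange bit `a_b` of `x` with bit `b_b` of `y`
and leave all other bits unchanged. -/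
theorem column_swap_inner_loop (x y x₁ y₁ x₂ a_m b_m : BitVec 64) (a_b b_b : ℕ)
    (hba : b_b ≤ a_b) (ha : a_b < 64)
    (ham : a_m = 1#64 <<< a_b) (hbm : b_m = 1#64 <<< b_b)
    (hx1 : x₁ = x ^^^ ((y &&& b_m) <<< (a_b - b_b)))
    (hy1 : y₁ = y ^^^ ((x₁ &&& a_m) >>> (a_b - b_b)))
    (hx2 : x₂ = x₁ ^^^ ((y₁ &&& b_m) <<< (a_b - b_b))) :
    x₂.getLsbD a_b = y.getLsbD b_b ∧
    y₁.getLsbD b_b = x.getLsbD a_b ∧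
    (∀ i : ℕ, i ≠ a_b → x₂.getLsbD i = x.getLsbD i) ∧
    (∀ i : ℕ, i ≠ b_b → y₁.getLsbD i = y.getLsbD i) := by
  subst ham hbm
  have h₁ (i : ℕ) : x₁.getLsbD i = (x.getLsbD i ^^ (decide (i = a_b) && y.getLsbD b_b)) := by
    rw [hx1, BitVec.getLsbD_xor, BitVec.getLsbD_and_one_shiftLeft_shiftLeft hba ha]
  have h₂ (i : ℕ) : y₁.getLsbD i = (y.getLsbD i ^^ (decide (i = b_b) && x₁.getLsbD a_b)) := by
    rw [hy1, BitVec.getLsbD_xor, BitVec.getLsbD_and_one_shiftLeft_ushiftRight hba ha]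
  have h₃ (i : ℕ) : x₂.getLsbD i = (x₁.getLsbD i ^^ (decide (i = a_b) && y₁.getLsbD b_b)) := by
    rw [hx2, BitVec.getLsbD_xor, BitVec.getLsbD_and_one_shiftLeft_shiftLeft hba ha]
  refine ⟨?_, ?_, fun i hi => ?_, fun i hi => ?_⟩
  · rw [h₃, h₂, h₁]
    cases x.getLsbD a_b <;> cases y.getLsbD b_b <;> simp
  · rw [h₂, h₁]
    cases x.getLsbD a_b <;> cases y.getLsbD b_b <;> simp
  · simp [h₃, h₁, hi]
  · simp [h₂, hi]
end
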